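/- arXiv:1702.04316 — 2 statements merged into one kernel-verified Lean document; each statement's English description precedes it below -/
import Mathlib

section
/- Let E be a real vector space, L : E → E a linear map, R : E → E an arbitrary map, and set N = R − L. Fix a stage index i ≥ 1, real coefficients a_{ij} for 1 ≤ j < i and ã_{ij} for 1 ≤ j ≤ i with ã_{ii} ≠ 0, a time step Δt, an element qⁿ ∈ E, and stage values q⁽¹⁾,…,q⁽ⁱ⁾ ∈ E. Set λ = ã_{ii}Δt, q_e⁽ⁱ⁾ = qⁿ + Δt Σ_{j<i} a_{ij} R(q⁽ʲ⁾), qᵗᵗ = q⁽ⁱ⁾ + Σ_{j<i} ((ã_{ij} − a_{ij})/ã_{ii}) q⁽ʲ⁾, and q_eᵗᵗ = q_e⁽ⁱ⁾ + Σ_{j<i} ((ã_{ij} − a_{ij})/ã_{ii}) q⁽ʲ⁾. Then the ARK stage equation q⁽ⁱ⁾ = qⁿ + Δt Σ_{j<i} a_{ij} N(q⁽ʲ⁾) + Δt Σ_{j≤i} ã_{ij} L(q⁽ʲ⁾) holds if and only if qᵗᵗ = q_eᵗᵗ + λ L(qᵗᵗ). -/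
/-- The ARK (IMEX additive Runge–Kutta) stage equation is equivalent to the
predictor-corrector form `qtt = qett + λ L qtt`, where `λ = ã_{ii} Δt`. -/
theorem ark_stage_predictor_corrector
    {E : Type*} [AddCommGroup E] [Module ℝ E]
    (L : E →ₗ[ℝ] E) (R : E → E) (N : E → E) (hN : ∀ q, N q = R q - L q)
    (i : ℕ) (hi : 1 ≤ i)
    (a ta : ℕ → ℝ) (hta : ta i ≠ 0)
    (Δt : ℝ) (qn : E) (q : ℕ → E)
    (lam : ℝ) (hlam : lam = ta i * Δt)
    (qe : E) (hqe : qe = qn + Δt • ∑ j ∈ Finset.Ico 1 i, a j • R (q j))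
    (qtt qett : E)
    (hqtt : qtt = q i + ∑ j ∈ Finset.Ico 1 i, ((ta j - a j) / ta i) • q j)
    (hqett : qett = qe + ∑ j ∈ Finset.Ico 1 i, ((ta j - a j) / ta i) • q j) :
    (q i = qn + Δt • (∑ j ∈ Finset.Ico 1 i, a j • N (q j))
        + Δt • (∑ j ∈ Finset.Icc 1 i, ta j • L (q j)))
      ↔ qtt = qett + lam • L qtt := by
  have h1 : ∑ j ∈ Finset.Icc 1 i, ta j • L (q j)
      = ∑ j ∈ Finset.Ico 1 i, ta j • L (q j) + ta i • L (q i) := by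
    rw [← Finset.sum_Ico_succ_top hi (fun j => ta j • L (q j))]
    rfl
  have h2 : ∑ j ∈ Finset.Ico 1 i, a j • N (q j)
      = ∑ j ∈ Finset.Ico 1 i, a j • R (q j) - ∑ j ∈ Finset.Ico 1 i, a j • L (q j) := by
    rw [← Finset.sum_sub_distrib]
    exact Finset.sum_congr rfl fun j _ => by rw [hN, smul_sub]
  have h3 : lam • L qtt = Δt • (ta i • L (q i)) + Δt • (∑ j ∈ Finset.Ico 1 i, ta j • L (q j)
      - ∑ j ∈ Finset.Ico 1 i, a j • L (q j)) := by
    rw [hqtt, map_add, map_sum, smul_add, hlam, mul_comm, mul_smul, mul_smul,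
      ← Finset.sum_sub_distrib, Finset.smul_sum (r := ta i)]
    congr 2
    refine Finset.sum_congr rfl fun j _ => ?_
    rw [map_smul, smul_smul, mul_div_cancel₀ _ hta, sub_smul]
  rw [h3, h1, h2, hqtt, hqett, hqe]
  generalize ∑ j ∈ Finset.Ico 1 i, ((ta j - a j) / ta i) • q j = S
  rw [add_right_comm _ S, add_left_inj]
  simp only [smul_add, smul_sub]
  constructor <;> intro h <;> refine h.trans ?_ <;> abel
end

section
/- Fix a real number λ, nonzero reals G₀ and F₀, vectors g, m₀, U, U_e, p ∈ ℝ³ (where m₀ represents ∇G₀ and p represents ∇Pᵗᵗ at a point), and reals ρ, ρ_e, Θ, Θ_e, P. Assume: (i) P = F₀Θ; (ii) Θ − G₀ρ = Θ_e − G₀ρ_e − λ U·m₀; (iii) the momentum equation U = U_e − λ[p + ρ g]. Define the linear map 𝒜 : ℝ³ → ℝ³ by 𝒜v = v + (λ²/G₀)(m₀·v) g, i.e. 𝒜 = I + λ²(g/G₀)m₀ᵀ. Then 𝒜U = U_e − λ p − λ (1/(F₀G₀)) P g − λ g (ρ_e − Θ_e/G₀). Moreover, if 𝒜 is invertible, then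 U = U_a − U_p, where U_a = 𝒜⁻¹[U_e − λ g (ρ_e − (1/G₀)Θ_e)] and U_p = 𝒜⁻¹[λ (p + (g/(F₀G₀)) P)]. -/
open scoped InnerProductSpace

/-- Velocity elimination step of the Schur-complement form for Set2C:
with `𝒜 = I + λ²(g/G₀) m₀ᵀ`, the corrector equations give
`𝒜 U = U_e − λ p − λ(1/(F₀G₀)) P g − λ g (ρ_e − Θ_e/G₀)`, and if `𝒜` is
invertible then `U = U_a − U_p`. -/
theorem set2c_schur_velocity_elimination
    (lam : ℝ) (G₀ F₀ : ℝ) (hG₀ : G₀ ≠ 0) (hF₀ : F₀ ≠ 0)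
    (g m₀ U U_e p : EuclideanSpace ℝ (Fin 3))
    (ρ ρ_e Θ Θ_e P : ℝ)
    (hP : P = F₀ * Θ)
    (hΘ : Θ - G₀ * ρ = Θ_e - G₀ * ρ_e - lam * ⟪U, m₀⟫_ℝ)
    (hU : U = U_e - lam • (p + ρ • g))
    (A : EuclideanSpace ℝ (Fin 3) →L[ℝ] EuclideanSpace ℝ (Fin 3))
    (hA : A = ContinuousLinearMap.id ℝ (EuclideanSpace ℝ (Fin 3))
        + (lam ^ 2 / G₀) • ((innerSL ℝ m₀).smulRight g)) :
    A U = U_e - lam • p - (lam * (1 / (F₀ * G₀)) * P) • g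
        - (lam * (ρ_e - Θ_e / G₀)) • g
    ∧ (IsUnit A →
        U = Ring.inverse A (U_e - lam • ((ρ_e - (1 / G₀) * Θ_e) • g))
          - Ring.inverse A (lam • (p + ((1 / (F₀ * G₀)) * P) • g))) := by
  have key : A U = U_e - lam • p - (lam * (1 / (F₀ * G₀)) * P) • g
        - (lam * (ρ_e - Θ_e / G₀)) • g := by
    have h1 : A U = U + (lam ^ 2 / G₀ * ⟪U, m₀⟫_ℝ) • g := by
      rw [hA, real_inner_comm]
      simp [smul_smul]
    rw [h1]
    generalize ⟪U, m₀⟫_ℝ = s at hΘ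
    have hρ : ρ = (Θ - Θ_e + G₀ * ρ_e + lam * s) / G₀ := by
      field_simp
      linarith
    have hs : lam * ρ = lam ^ 2 / G₀ * s + lam * (1 / (F₀ * G₀)) * P
        + lam * (ρ_e - Θ_e / G₀) := by
      rw [hρ, hP]
      field_simp
      ring
    rw [hU, smul_add, smul_smul, hs]
    module
  refine ⟨key, fun hu => ?_⟩
  have h2 : Ring.inverse A (A U) = U := by
    have := Ring.inverse_mul_cancel A hu
    exact congrArg (fun B : EuclideanSpace ℝ (Fin 3) →L[ℝ] EuclideanSpace ℝ (Fin 3) => B U) this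
  rw [← map_sub]
  conv_lhs => rw [← h2, key]
  congr 1
  rw [show Θ_e / G₀ = (1 / G₀) * Θ_e by ring]
  module
end
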